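/- arXiv:math/0612458 — 2 statements merged into one kernel-verified Lean document; each statement's English description precedes it below -/
import Mathlib

section
/- The lattice L(S,≤) does not have the selection property. -/
universe u

/-- `(A, B)` is a pregap in a (pre)ordered set. -/
def IsPregap {P : Type u} [Preorder P] (A B : Set P) : Prop :=
  ∀ a ∈ A, ∀ b ∈ B, a ≤ b

/-- `(A, B)` is a gap: a pregap which cannot be separated by any element. -/
def IsGap {P : Type u} [Preorder P] (A B : Set P) : Prop :=
  IsPregap A B ∧ ¬ ∃ x : P, (∀ a ∈ A, a ≤ x) ∧ (∀ b ∈ B, x ≤ b)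

/-- The chain-gap property: every gap is preserved by a monotone map to some chain. -/
def ChainGapProperty (P : Type u) [Preorder P] : Prop :=
  ∀ A B : Set P, IsGap A B →
    ∃ (C : Type u) (lo : LinearOrder C) (g : P → C),
      @Monotone P C _ lo.toPreorder g ∧ @IsGap C lo.toPreorder (g '' A) (g '' B)

/-- The reflexive closure `x ≤_{ω₁} y` of the well-ordering `w` of `S`. -/
def leW {S : Set ℝ} (w : S → S → Prop) (x y : S) : Prop := w x y ∨ x = y

/-- The Sierpinskization order on `S`: `x ≤ y` iff `x ≤_{ω₁} y` and `x ≤_ℝ y`. -/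
def poS {S : Set ℝ} (w : S → S → Prop) (x y : S) : Prop :=
  leW w x y ∧ (x : ℝ) ≤ (y : ℝ)

/-- The principal initial segment `↓x` of the Sierpinskization `(S, ≤)`. -/
def dseg {S : Set ℝ} (w : S → S → Prop) (x : S) : Set S := {y | poS w y x}

/-- Membership in `L(S,≤)`: finite unions of finite intersections of principal
initial segments of `(S, ≤)`. -/
def Lmem {S : Set ℝ} (w : S → S → Prop) (X : Set S) : Prop :=
  ∃ F : Finset (Finset S), F.Nonempty ∧ (∀ G ∈ F, G.Nonempty) ∧
    X = ⋃ G ∈ F, ⋂ x ∈ G, dseg w x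

/-- The lattice `L(S,≤)`, ordered by inclusion. -/
abbrev LS (S : Set ℝ) (w : S → S → Prop) : Type := {X : Set S // Lmem w X}

/-- The hypotheses on `S` and the well-ordering `w`: `S ⊆ ℝ` is `ℵ₁`-dense of
cardinality `ℵ₁`, has no greatest or least element, and `w` has order type `ω₁`. -/
def SierpCond (S : Set ℝ) (w : S → S → Prop) [IsWellOrder S w] : Prop :=
  Cardinal.mk ↥S = Cardinal.aleph 1 ∧
  (∀ a b : S, (a : ℝ) < (b : ℝ) →
    Cardinal.aleph 1 ≤ Cardinal.mk ↥{x : S | (a : ℝ) < (x : ℝ) ∧ (x : ℝ) < (b : ℝ)}) ∧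
  (∀ a : S, ∃ b : S, (a : ℝ) < (b : ℝ)) ∧
  (∀ a : S, ∃ b : S, (b : ℝ) < (a : ℝ)) ∧
  Ordinal.type w = (Cardinal.aleph 1).ord

/-- A separable pregap: a pregap admitting a separating element. -/
def SeparablePregap {P : Type u} [Preorder P] (A B : Set P) : Prop :=
  IsPregap A B ∧ ∃ x : P, (∀ a ∈ A, a ≤ x) ∧ (∀ b ∈ B, x ≤ b)

/-- The quasiordering of pregaps: `(A,B) ≤ (A',B')` iff every element of `A` is
below some element of `A'` and every element of `B` is above some element of `B'`. -/
def PregapLE {P : Type u} [Preorder P] (p q : Set P × Set P) : Prop :=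
  (∀ a ∈ p.1, ∃ a' ∈ q.1, a ≤ a') ∧ (∀ b ∈ p.2, ∃ b' ∈ q.2, b' ≤ b)

/-- The selection property: an order-preserving map on the separable pregaps `B(P)`
picking a separating element for each separable pregap. -/
def SelectionProperty (P : Type u) [Preorder P] : Prop :=
  ∃ φ : {p : Set P × Set P // SeparablePregap p.1 p.2} → P,
    (∀ p q, PregapLE p.1 q.1 → φ p ≤ φ q) ∧
    ∀ p, (∀ a ∈ p.1.1, a ≤ φ p) ∧ (∀ b ∈ p.1.2, φ p ≤ b)

lemma countable_not_w {S : Set ℝ} (w : S → S → Prop) [IsWellOrder S w]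
    (h : SierpCond S w) (c : S) : {x : S | ¬ w c x}.Countable := by
  have h5 := h.2.2.2.2
  have h1 : {x : S | w x c}.Countable := by
    have h2 : Ordinal.typein w c < (Cardinal.aleph 1).ord := h5 ▸ Ordinal.typein_lt_type w c
    rw [Cardinal.lt_ord] at h2
    have h3 : Cardinal.mk {x : S | w x c} = (Ordinal.typein w c).card := rfl
    rw [← Set.countable_coe_iff, ← Cardinal.mk_le_aleph0_iff, h3]
    rw [← Order.lt_succ_iff, Cardinal.succ_aleph0]
    exact h2
  refine (h1.union (Set.countable_singleton c)).mono ?_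
  intro x hx
  rcases trichotomous_of w c x with h | h | h
  · exact absurd h hx
  · right; exact h.symm
  · left; exact h

lemma exists_big {S : Set ℝ} (w : S → S → Prop) [IsWellOrder S w]
    (h : SierpCond S w) (C : Set S) (hC : C.Countable) (a b : S) (hab : (a : ℝ) < b) :
    ∃ d : S, (a : ℝ) < d ∧ (d : ℝ) < b ∧ ∀ c ∈ C, w c d := by
  by_contra hcon
  push Not at hcon
  have h1 : (⋃ c ∈ C, {x : S | ¬ w c x}).Countable :=
    hC.biUnion fun c _ => countable_not_w w h c
  have h2 : {x : S | (a : ℝ) < (x : ℝ) ∧ (x : ℝ) < (b : ℝ)}.Countable := by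
    refine h1.mono ?_
    rintro x ⟨hx1, hx2⟩
    obtain ⟨c, hc, hcx⟩ := hcon x hx1 hx2
    simp only [Set.mem_iUnion]
    exact ⟨c, hc, hcx⟩
  have h3 := h.2.1 a b hab
  rw [← Set.countable_coe_iff, ← Cardinal.mk_le_aleph0_iff] at h2
  exact absurd (h3.trans h2) (not_le.2 Cardinal.aleph0_lt_aleph_one)

lemma Lmem_dseg {S : Set ℝ} (w : S → S → Prop) (x : S) : Lmem w (dseg w x) :=
  ⟨{{x}}, by simp, by simp, by simp only [Finset.mem_singleton, Set.iUnion_iUnion_eq_left, Set.iInter_iInter_eq_left]⟩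

theorem LS_not_selectionProperty (S : Set ℝ) (w : S → S → Prop) [IsWellOrder S w]
    (h : SierpCond S w) : ¬ SelectionProperty (LS S w) := by
  rintro ⟨φ, hmono, hsel⟩
  have hne : Nonempty S := by
    rw [← Cardinal.mk_ne_zero_iff, h.1]
    exact (Cardinal.aleph_pos 1).ne'
  obtain ⟨t⟩ := hne
  obtain ⟨b, htb⟩ := h.2.2.1 t
  obtain ⟨Q, hQc, hQd⟩ := TopologicalSpace.exists_countable_dense S
  have hQ : ∀ a b : S, (a : ℝ) < b → ∃ q ∈ Q, (a : ℝ) < q ∧ (q : ℝ) < b := by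
    intro a b hab
    obtain ⟨d, hd1, hd2, -⟩ := exists_big w h ∅ Set.countable_empty a b hab
    have ho : IsOpen {x : S | (a : ℝ) < x ∧ (x : ℝ) < b} :=
      (isOpen_lt continuous_const continuous_subtype_val).inter
        (isOpen_lt continuous_subtype_val continuous_const)
    obtain ⟨q, hq1, hq2⟩ := hQd.exists_mem_open ho ⟨d, hd1, hd2⟩
    exact ⟨q, hq1, hq2⟩
  obtain ⟨e, -, -, he⟩ := exists_big w h (insert t Q) (hQc.insert t) t b htb
  have hx : ∀ q : S, ∃ x : S, (q : ℝ) < t → ((q : ℝ) < x ∧ (x : ℝ) < t ∧ w e x) := by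
    intro q
    by_cases hq : (q : ℝ) < t
    · obtain ⟨x, h1, h2, h3⟩ := exists_big w h {e} (Set.countable_singleton e) q t hq
      exact ⟨x, fun _ => ⟨h1, h2, h3 e rfl⟩⟩
    · exact ⟨q, fun h => absurd h hq⟩
  choose f hf using hx
  let T : Set S := f '' {q | q ∈ Q ∧ (q : ℝ) < t}
  have hTc : T.Countable := (hQc.mono fun q hq => hq.1).image f
  have hT : ∀ x ∈ T, (x : ℝ) < t ∧ w e x := by
    rintro _ ⟨q, hq, rfl⟩
    exact (hf q hq.2).2
  have hcof : ∀ a : S, (a : ℝ) < t → ∃ x ∈ T, (a : ℝ) < x := by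
    intro a ha
    obtain ⟨q, hq, h1, h2⟩ := hQ a t ha
    exact ⟨f q, ⟨q, ⟨hq, h2⟩, rfl⟩, h1.trans (hf q h2).1⟩
  let D : S → LS S w := fun x => ⟨dseg w x, Lmem_dseg w x⟩
  let A : Set (LS S w) := D '' T
  have hub : ∀ d : S, (t : ℝ) < d → (∀ x ∈ T, w x d) → ∀ a ∈ A, a ≤ D d := by
    rintro d hd1 hd2 _ ⟨x, hxT, rfl⟩ y ⟨hy1, hy2⟩
    refine ⟨Or.inl ?_, hy2.trans ((hT x hxT).1.le.trans hd1.le)⟩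
    rcases hy1 with hy | rfl
    · exact _root_.trans hy (hd2 x hxT)
    · exact hd2 _ hxT
  obtain ⟨d0, hd01, -, hd02⟩ := exists_big w h T hTc t b htb
  have hsep : SeparablePregap A (∅ : Set (LS S w)) :=
    ⟨fun a _ b hb => hb.elim, D d0, hub d0 hd01 hd02, fun b hb => hb.elim⟩
  obtain ⟨X, hX⟩ : ∃ X, X = φ ⟨(A, ∅), hsep⟩ := ⟨_, rfl⟩
  have hXA : ∀ a ∈ A, a ≤ X := hX ▸ (hsel ⟨(A, ∅), hsep⟩).1
  have hXle : ∀ d : S, (t : ℝ) < d → (∀ x ∈ T, w x d) → X ≤ D d := by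
    intro d hd1 hd2
    have hs : SeparablePregap ({D d} : Set (LS S w)) {D d} := by
      refine ⟨?_, D d, ?_, ?_⟩
      · rintro a rfl b rfl; exact le_rfl
      · rintro a rfl; exact le_rfl
      · rintro a rfl; exact le_rfl
    have h1 : φ ⟨(A, ∅), hsep⟩ ≤ φ ⟨({D d}, {D d}), hs⟩ :=
      hmono _ _ ⟨fun a ha => ⟨D d, rfl, hub d hd1 hd2 a ha⟩, fun b hb => hb.elim⟩
    rw [hX]
    exact h1.trans ((hsel ⟨({D d}, {D d}), hs⟩).2 _ rfl)
  obtain ⟨F, -, hG, hXF⟩ := X.2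
  -- a point of `T` above all the generators below `t`
  have hxx : ∃ x ∈ T, ∀ G ∈ F, ∀ g ∈ G, (g : ℝ) < t → (g : ℝ) < x := by
    classical
    obtain ⟨a0, ha0⟩ := h.2.2.2.1 t
    let U : Finset S := insert a0 ((F.biUnion id).filter fun g => (g : ℝ) < t)
    obtain ⟨m, hm, hmax⟩ := U.exists_max_image (fun g => (g : ℝ)) ⟨a0, by simp [U]⟩
    have hmt : (m : ℝ) < t := by
      simp only [U, Finset.mem_insert, Finset.mem_filter] at hm
      rcases hm with rfl | hm
      · exact ha0
      · exact hm.2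
    obtain ⟨x, hxT, hmx⟩ := hcof m hmt
    refine ⟨x, hxT, fun G hGF g hg hgt => lt_of_le_of_lt (hmax g ?_) hmx⟩
    simp only [U, Finset.mem_insert, Finset.mem_filter, Finset.mem_biUnion, id]
    exact Or.inr ⟨⟨G, hGF, hg⟩, hgt⟩
  obtain ⟨x, hxT, hxg⟩ := hxx
  have hxX : x ∈ X.1 := hXA (D x) ⟨x, hxT, rfl⟩ ⟨Or.inr rfl, le_rfl⟩
  rw [hXF] at hxX
  simp only [Set.mem_iUnion, Set.mem_iInter] at hxX
  obtain ⟨G, hGF, hxG⟩ := hxX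
  have hwtx : w t x := _root_.trans (he t (Set.mem_insert _ _)) (hT x hxT).2
  have hgt : ∀ g ∈ G, (t : ℝ) < g := by
    intro g hg
    have h1 := hxG g hg
    rcases lt_trichotomy (t : ℝ) g with h2 | h2 | h2
    · exact h2
    · exfalso
      have : t = g := Subtype.ext h2
      subst this
      rcases h1.1 with h3 | h3
      · exact asymm h3 hwtx
      · subst h3; exact irrefl _ hwtx
    · exact absurd h1.2 (not_le.2 (hxg G hGF g hg h2))
  obtain ⟨g0, hg0, hmin⟩ := G.exists_min_image (fun g => (g : ℝ)) (hG G hGF)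
  obtain ⟨z, hzQ, hz1, hz2⟩ := hQ t g0 (hgt g0 hg0)
  have hwzx : w z x := _root_.trans (he z (Set.mem_insert_of_mem _ hzQ)) (hT x hxT).2
  have hzX : z ∈ X.1 := by
    rw [hXF]
    simp only [Set.mem_iUnion, Set.mem_iInter]
    refine ⟨G, hGF, fun g hg => ⟨Or.inl ?_, hz2.le.trans (hmin g hg)⟩⟩
    rcases (hxG g hg).1 with h3 | h3
    · exact _root_.trans hwzx h3
    · exact h3 ▸ hwzx
  obtain ⟨d, hd1, hd2, hd3⟩ := exists_big w h T hTc t z hz1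
  exact absurd (hXle d hd1 hd3 hzX).2 (not_le.2 hd2)
end

section
/- The ordinal ω₁ does not order-embed into the lattice L(S,≤); equivalently, there is no strictly increasing ω₁-sequence of elements of L(S,≤). -/
universe u

open Set in
lemma aux_cofinal {ι : Type*} (T : Set ι) (f : ι → ℝ) :
    ∃ D ⊆ T, D.Countable ∧ ∀ t ∈ T, ∃ d ∈ D, f t ≤ f d := by
  classical
  by_cases hm : ∃ c ∈ T, ∀ c' ∈ T, f c' ≤ f c
  · obtain ⟨c, hc, hm⟩ := hm
    exact ⟨{c}, by simpa using hc, countable_singleton c, fun t ht => ⟨c, rfl, hm t ht⟩⟩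
  · push Not at hm
    have : ∀ q : {q : ℚ // ∃ c ∈ T, (q : ℝ) < f c}, ∃ c ∈ T, ((q : ℚ) : ℝ) < f c := fun q => q.2
    choose s hs hs' using this
    refine ⟨range s, ?_, countable_range s, ?_⟩
    · rintro _ ⟨q, rfl⟩; exact hs q
    · intro t ht
      obtain ⟨c, hc, hlt⟩ := hm t ht
      obtain ⟨q, h1, h2⟩ := exists_rat_btwn hlt
      exact ⟨_, ⟨⟨q, c, hc, h2⟩, rfl⟩, (h1.trans (hs' ⟨q, c, hc, h2⟩)).le⟩

/-- condensation: all but countably many points of `U` have uncountably many points of `U` above. -/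
lemma aux_cond {ι : Type*} (U : Set ι) (f : ι → ℝ) :
    {x | x ∈ U ∧ {y | y ∈ U ∧ f x ≤ f y}.Countable}.Countable := by
  obtain ⟨D, hDT, hD, hcof⟩ :=
    aux_cofinal {x | x ∈ U ∧ {y | y ∈ U ∧ f x ≤ f y}.Countable} (fun x => - f x)
  refine (hD.biUnion (t := fun d _ => {y | y ∈ U ∧ f d ≤ f y}) fun d hd => (hDT hd).2).mono ?_
  intro x hx
  obtain ⟨d, hd, hle⟩ := hcof x hx
  simp only [Set.mem_iUnion]
  exact ⟨d, hd, hx.1, by linarith⟩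

lemma aux_three (R : Set ℝ) (hR : R.Infinite) :
    ∃ a ∈ R, ∃ b ∈ R, ∃ c ∈ R, a < b ∧ b < c := by
  obtain ⟨t, ht, hc⟩ := hR.exists_subset_card_eq 3
  have e := t.orderEmbOfFin hc
  refine ⟨t.orderEmbOfFin hc 0, ht (t.orderEmbOfFin_mem hc 0), t.orderEmbOfFin hc 1,
    ht (t.orderEmbOfFin_mem hc 1), t.orderEmbOfFin hc 2, ht (t.orderEmbOfFin_mem hc 2), ?_, ?_⟩
  · exact (t.orderEmbOfFin hc).strictMono (by decide)
  · exact (t.orderEmbOfFin hc).strictMono (by decide)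

lemma leW_of_not {S : Set ℝ} {w : S → S → Prop} [IsWellOrder S w] {x y : S} (h : ¬ w x y) :
    leW w y x := by
  rcases trichotomous_of w x y with h1 | h1 | h1
  · exact absurd h1 h
  · exact Or.inr h1.symm
  · exact Or.inl h1

lemma leW_trans {S : Set ℝ} {w : S → S → Prop} [IsWellOrder S w] {x y z : S}
    (h : leW w x y) (h' : leW w y z) : leW w x z := by
  rcases h with h | rfl
  · rcases h' with h' | rfl
    · exact Or.inl (_root_.trans h h')
    · exact Or.inl h
  · exact h'

theorem aux_main (S : Set ℝ) (w : S → S → Prop) [IsWellOrder S w]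
    (hI : ∀ b, {y | w y b}.Countable) (hS : ¬ (Set.univ : Set S).Countable)
    (hdense : ∀ a b : S, (a : ℝ) < (b : ℝ) →
      ¬ {x : S | (a : ℝ) < (x : ℝ) ∧ (x : ℝ) < (b : ℝ)}.Countable)
    (g : S → Set S) (hL : ∀ s, Lmem w (g s)) (hg : ∀ s t, w s t → g s ⊂ g t) : False := by
  classical
  have hIle : ∀ b, {y | leW w y b}.Countable := fun b =>
    ((hI b).union (Set.countable_singleton b)).mono (by
      rintro y (h | h)
      · exact Or.inl h
      · exact Or.inr h)
  -- uncountable sets are unbounded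
  have hunb : ∀ A : Set S, ¬ A.Countable → ∀ b, ∃ y ∈ A, w b y := by
    intro A hA b
    by_contra hcon
    push Not at hcon
    exact hA ((hIle b).mono fun y hy => leW_of_not (hcon y hy))
  -- countable sets are bounded
  have hbdd : ∀ D : Set S, D.Countable → ∃ b, ∀ d ∈ D, w d b := by
    intro D hD
    by_contra hcon
    push Not at hcon
    refine hS ((hD.biUnion (t := fun d _ => {y | leW w y d}) fun d _ => hIle d).mono ?_)
    intro x _
    obtain ⟨d, hd, hx⟩ := hcon x
    simp only [Set.mem_iUnion]
    exact ⟨d, hd, leW_of_not hx⟩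
  set U : Set S := ⋃ s, g s with hU
  have hUunc : ¬ U.Countable := by
    intro hc
    have : ∀ x : S, ∃ b, x ∈ U → x ∈ g b := by
      intro x
      by_cases hx : x ∈ U
      · obtain ⟨b, hb⟩ := Set.mem_iUnion.1 hx
        exact ⟨b, fun _ => hb⟩
      · exact ⟨x, fun h => absurd h hx⟩
    choose i hi using this
    obtain ⟨b, hb⟩ := hbdd (i '' U) (hc.image i)
    obtain ⟨b', _, hb'⟩ := hunb _ hS b
    obtain ⟨x, hx, hx'⟩ := Set.exists_of_ssubset (hg _ _ hb')
    have hxU : x ∈ U := Set.mem_iUnion.2 ⟨b', hx⟩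
    exact hx' ((hg _ _ (hb _ ⟨x, hxU, rfl⟩)).1 (hi x hxU))
  set C : Set S := {x | ¬ {y | y ∈ U ∧ (x : ℝ) ≤ (y : ℝ)}.Countable} with hC
  have hCne : C.Nonempty := by
    by_contra hne
    rw [Set.not_nonempty_iff_eq_empty] at hne
    refine hUunc (Set.Countable.mono ?_ (aux_cond U (fun x : S => (x : ℝ))))
    intro x hx
    refine ⟨hx, ?_⟩
    by_contra hcon
    have : x ∈ C := hcon
    rw [hne] at this
    exact this
  have hA : ∀ b : S, ∃ r : S, leW w b r ∧ (∀ c ∈ C, (c : ℝ) ≤ r) ∧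
      ∀ z, leW w z b → (z : ℝ) ≤ r → z ∈ U := by
    intro b
    obtain ⟨D, hDC, hD, hcof⟩ := aux_cofinal C (fun x : S => (x : ℝ))
    have h1 : ∀ d : S, ∃ y s, d ∈ C → y ∈ g s ∧ (d : ℝ) ≤ y ∧ w b y := by
      intro d
      by_cases hd : d ∈ C
      · obtain ⟨y, ⟨hyU, hy⟩, hby⟩ := hunb _ hd b
        obtain ⟨s, hs⟩ := Set.mem_iUnion.1 hyU
        exact ⟨y, s, fun _ => ⟨hs, hy, hby⟩⟩
      · exact ⟨d, d, fun h => absurd h hd⟩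
    choose y s hys using h1
    obtain ⟨t, ht⟩ := hbdd (s '' D) (hD.image s)
    obtain ⟨F, hFne, hGne, hF⟩ := hL t
    have h2 : ∃ G ∈ F, ∀ c ∈ C, ∃ z, (z ∈ ⋂ x ∈ G, dseg w x) ∧ (c : ℝ) ≤ z ∧ w b z := by
      by_contra hcon
      push Not at hcon
      have : Nonempty S := ⟨b⟩
      choose! k hkC hk using hcon
      obtain ⟨G₀, hG₀, hmax⟩ := F.exists_max_image (fun G => (k G : ℝ)) hFne
      obtain ⟨d, hd, hkd⟩ := hcof _ (hkC G₀ hG₀)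
      obtain ⟨e1, e2, e3⟩ := hys d (hDC hd)
      have e4 : y d ∈ g t := (hg _ _ (ht _ ⟨d, hd, rfl⟩)).1 e1
      rw [hF] at e4
      simp only [Set.mem_iUnion] at e4
      obtain ⟨G, hG, hyG⟩ := e4
      exact hk G hG (y d) hyG (((hmax G hG).trans hkd).trans e2) e3
    obtain ⟨G, hG, hGc⟩ := h2
    obtain ⟨r, hrG, hr⟩ := G.exists_min_image (fun x => (x : ℝ)) (hGne G hG)
    refine ⟨r, ?_, ?_, ?_⟩
    · obtain ⟨c, hc⟩ := hCne
      obtain ⟨z, hz, _, hbz⟩ := hGc c hc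
      exact leW_trans (Or.inl hbz) (Set.mem_iInter₂.1 hz r hrG).1
    · intro c hc
      obtain ⟨z, hz, hcz, _⟩ := hGc c hc
      exact hcz.trans (Set.mem_iInter₂.1 hz r hrG).2
    · intro z hzb hzr
      refine Set.mem_iUnion.2 ⟨t, ?_⟩
      rw [hF]
      simp only [Set.mem_iUnion]
      refine ⟨G, hG, Set.mem_iInter₂.2 fun x hx => ⟨?_, hzr.trans (hr x hx)⟩⟩
      obtain ⟨c, hc⟩ := hCne
      obtain ⟨z', hz', _, hbz⟩ := hGc c hc
      exact leW_trans hzb (leW_trans (Or.inl hbz) (Set.mem_iInter₂.1 hz' x hx).1)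
  choose r hr1 hr2 hr3 using hA
  -- indices `b` with uncountably many `b'` such that `r b ≤ r b'`
  have hcond := aux_cond (Set.univ : Set S) (fun b => (r b : ℝ))
  set B : Set S := {b | ¬ {b' | b' ∈ (Set.univ : Set S) ∧ (r b : ℝ) ≤ r b'}.Countable} with hB
  have hBunc : ¬ B.Countable := by
    intro hc
    refine hS ((hc.union hcond).mono fun x _ => ?_)
    by_cases hx : x ∈ B
    · exact Or.inl hx
    · exact Or.inr ⟨trivial, not_not.1 hx⟩
  have hRinf : ((fun b => (r b : ℝ)) '' B).Infinite := by
    intro hfin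
    have hfin2 : (r '' B).Finite := by
      have : ((fun x : S => (x : ℝ)) '' (r '' B)).Finite := by rwa [Set.image_image]
      exact this.of_finite_image Subtype.val_injective.injOn
    obtain ⟨t, ht⟩ := hbdd _ hfin2.countable
    obtain ⟨b, hb, htb⟩ := hunb B hBunc t
    have h1 : w (r b) t := ht _ ⟨b, hb, rfl⟩
    have h2 : w (r b) b := _root_.trans h1 htb
    rcases hr1 b with h3 | h3
    · exact asymm_of w h2 h3
    · rw [← h3] at h2; exact irrefl_of w _ h2
  obtain ⟨_, ⟨b0, hb0, rfl⟩, _, ⟨b1, hb1, rfl⟩, _, ⟨b2, hb2, rfl⟩, h01, h12⟩ :=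
    aux_three _ hRinf
  have hsub : ∀ z : S, (z : ℝ) ≤ r b2 → z ∈ U := by
    intro z hz
    obtain ⟨b', ⟨_, hb'⟩, hzb⟩ := hunb _ hb2 z
    exact hr3 b' z (Or.inl hzb) (hz.trans hb')
  have hC1 : r b1 ∈ C := by
    intro hc
    refine hdense _ _ h12 (Set.Countable.mono ?_ hc)
    intro x hx
    exact ⟨hsub x hx.2.le, hx.1.le⟩
  exact absurd (hr2 b0 _ hC1) (not_le.2 h01)

theorem omega1_not_embeds_in_LS (S : Set ℝ) (w : S → S → Prop) [IsWellOrder S w]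
    (h : SierpCond S w) :
    ¬ ∃ f : ↥(Set.Iio (Cardinal.aleph 1).ord) → LS S w, StrictMono f := by
  rintro ⟨f, hf⟩
  obtain ⟨hcard, hdense, _, _, htype⟩ := h
  have hlt0 : ∀ s : S, Ordinal.typein w s < (Cardinal.aleph 1).ord := fun s =>
    htype ▸ Ordinal.typein_lt_type w s
  have hlt : ∀ s : S, Ordinal.lift (Ordinal.typein w s) < (Cardinal.aleph 1).ord := by
    intro s
    have h1 := Ordinal.lift_lt.2 (hlt0 s)
    rw [Cardinal.lift_ord, Cardinal.lift_aleph, Ordinal.lift_one] at h1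
    exact h1
  have hnc : ∀ A : Set S, Cardinal.aleph 1 ≤ Cardinal.mk A → ¬ A.Countable := by
    intro A hA hc
    have h1 := hA.trans (Cardinal.le_aleph0_iff_set_countable.2 hc)
    exact absurd h1 (not_le.2 Cardinal.aleph0_lt_aleph_one)
  refine aux_main S w ?_ ?_ (fun a b hab => hnc _ (hdense a b hab))
    (fun s => (f ⟨Ordinal.lift (Ordinal.typein w s), hlt s⟩).1) (fun s => (f _).2) ?_
  · intro b
    have h1 := Cardinal.lt_ord.1 (hlt0 b)
    rw [Ordinal.card_typein] at h1
    rw [← Cardinal.le_aleph0_iff_set_countable]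
    rw [← Cardinal.succ_aleph0] at h1
    exact Order.lt_succ_iff.1 h1
  · apply hnc
    rw [Cardinal.mk_univ, hcard]
  · intro s t hst
    apply hf
    exact Ordinal.lift_lt.2 ((Ordinal.typein_lt_typein w).2 hst)
end
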